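/- The kissing number in dimension 16 is at most 8312: every finite set of unit vectors x_1, …, x_N in ℝ^{16} satisfying ⟨x_i, x_j⟩ ≤ 1/2 for all i ≠ j has N ≤ 8312. -/

import Mathlib

open scoped RealInnerProductSpace BigOperators

open MvPolynomial in
/-- The Laplacian on polynomials. -/
noncomputable def polyLaplacian (n : ℕ) :
    MvPolynomial (Fin n) ℝ →ₗ[ℝ] MvPolynomial (Fin n) ℝ :=
  ∑ i, (pderiv i).toLinearMap ∘ₗ (pderiv i).toLinearMap

/-- The Fischer inner product `⟨p, q⟩ = (p(∂) q)(0)` on polynomials. -/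
noncomputable def fischer (n : ℕ) :
    MvPolynomial (Fin n) ℝ →ₗ[ℝ] MvPolynomial (Fin n) ℝ →ₗ[ℝ] ℝ :=
  (MvPolynomial.basisMonomials (Fin n) ℝ).constr ℝ fun α =>
    ((∏ i, (α i).factorial : ℕ) : ℝ) • MvPolynomial.lcoeff ℝ α

/-- The linear form `y ↦ ⟨x, y⟩` as a polynomial. -/
noncomputable def linForm {n : ℕ} (x : Fin n → ℝ) : MvPolynomial (Fin n) ℝ :=
  ∑ i, MvPolynomial.C (x i) * MvPolynomial.X i

/-- The quadratic form `y ↦ |y|²` as a polynomial. -/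
noncomputable def normSqPoly (n : ℕ) : MvPolynomial (Fin n) ℝ :=
  ∑ i, MvPolynomial.X i ^ 2

namespace MvPolynomial

variable {n : ℕ}

theorem polyLaplacian_apply (p : MvPolynomial (Fin n) ℝ) :
    polyLaplacian n p = ∑ i, pderiv i (pderiv i p) := by
  simp [polyLaplacian]

theorem polyLaplacian_mul (p q : MvPolynomial (Fin n) ℝ) :
    polyLaplacian n (p * q) =
      polyLaplacian n p * q + 2 * ∑ i, pderiv i p * pderiv i q + p * polyLaplacian n q := by
  simp only [polyLaplacian_apply, Derivation.leibniz, map_add, smul_eq_mul, Finset.mul_sum,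
    Finset.sum_mul, ← Finset.sum_add_distrib]
  exact Finset.sum_congr rfl fun i _ => by ring

theorem pderiv_linForm (x : Fin n → ℝ) (i : Fin n) : pderiv i (linForm x) = C (x i) := by
  simp [linForm, pderiv_X, Pi.single_apply]

theorem pderiv_normSqPoly (i : Fin n) : pderiv i (normSqPoly n) = 2 * X i := by
  simp [normSqPoly, Derivation.leibniz_pow, pderiv_X, Pi.single_apply, two_mul]

theorem pderiv_linForm_pow (x : Fin n → ℝ) (m : ℕ) (i : Fin n) :
    pderiv i (linForm x ^ m) = C ((m : ℝ) * x i) * linForm x ^ (m - 1) := by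
  rw [pderiv_pow, pderiv_linForm, map_mul, map_natCast]
  ring

theorem pderiv_normSqPoly_pow (m : ℕ) (i : Fin n) :
    pderiv i (normSqPoly n ^ m) = C (2 * (m : ℝ)) * (X i * normSqPoly n ^ (m - 1)) := by
  rw [pderiv_pow, pderiv_normSqPoly, map_mul, map_natCast, map_ofNat]
  ring

theorem polyLaplacian_linForm_pow {x : Fin n → ℝ} (hx : ∑ i, x i ^ 2 = 1) (m : ℕ) :
    polyLaplacian n (linForm x ^ m) = C ((m : ℝ) * (m - 1)) * linForm x ^ (m - 2) := by
  have h (i : Fin n) : pderiv i (pderiv i (linForm x ^ m)) =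
      C (x i ^ 2) * (C ((m : ℝ) * (m - 1)) * linForm x ^ (m - 2)) := by
    rw [pderiv_linForm_pow, pderiv_C_mul, pderiv_linForm_pow]
    rcases m with _ | m
    · simp
    · rw [show m + 1 - 2 = m - 1 by lia]
      simp only [map_mul, map_pow, map_one, Nat.cast_add, Nat.cast_one, Nat.add_sub_cancel,
        map_add, add_sub_cancel_right]
      ring
  simp_rw [polyLaplacian_apply, h]
  rw [← Finset.sum_mul, ← map_sum, hx, map_one, one_mul]

theorem sum_X_mul_X : ∑ i, X i * X i = normSqPoly n := by
  simp [normSqPoly, sq]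

theorem polyLaplacian_normSqPoly_pow (m : ℕ) :
    polyLaplacian n (normSqPoly n ^ m) =
      C (2 * (m : ℝ) * (2 * m - 2 + n)) * normSqPoly n ^ (m - 1) := by
  have h (i : Fin n) : pderiv i (pderiv i (normSqPoly n ^ m)) =
      C (2 * (m : ℝ)) * (normSqPoly n ^ (m - 1) +
        C (2 * ((m - 1 : ℕ) : ℝ)) * (X i * X i) * normSqPoly n ^ (m - 1 - 1)) := by
    rw [pderiv_normSqPoly_pow, pderiv_C_mul, pderiv_mul, pderiv_X_self, pderiv_normSqPoly_pow]
    ring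
  simp_rw [polyLaplacian_apply, h]
  rw [← Finset.mul_sum, Finset.sum_add_distrib, ← Finset.sum_mul, ← Finset.mul_sum, sum_X_mul_X]
  rcases m with _ | _ | m
  · simp
  · simp
  · simp only [Finset.sum_const, Finset.card_univ, Fintype.card_fin, nsmul_eq_mul, map_mul,
      map_add, map_sub, map_natCast, map_ofNat, Nat.add_sub_cancel]
    push_cast
    ring

theorem sum_C_mul_X (x : Fin n → ℝ) : ∑ i, C (x i) * X i = linForm x := rfl

theorem polyLaplacian_linForm_pow_mul {x : Fin n → ℝ} (hx : ∑ i, x i ^ 2 = 1) (m j : ℕ) :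
    polyLaplacian n (linForm x ^ m * normSqPoly n ^ j) =
      ((m : ℝ) * (m - 1)) • (linForm x ^ (m - 2) * normSqPoly n ^ j) +
      (2 * (j : ℝ) * (2 * m + 2 * j - 2 + n)) •
        (linForm x ^ m * normSqPoly n ^ (j - 1)) := by
  have h : ∑ i, pderiv i (linForm x ^ m) * pderiv i (normSqPoly n ^ j) =
      C (2 * (j : ℝ) * m) * (linForm x ^ m * normSqPoly n ^ (j - 1)) := by
    have h' (i : Fin n) : pderiv i (linForm x ^ m) * pderiv i (normSqPoly n ^ j) =
        C (2 * (j : ℝ) * m) * (linForm x ^ (m - 1) * normSqPoly n ^ (j - 1)) *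
          (C (x i) * X i) := by
      rw [pderiv_linForm_pow, pderiv_normSqPoly_pow]
      simp only [map_mul]
      ring
    simp_rw [h']
    rw [← Finset.mul_sum, sum_C_mul_X]
    rcases m with _ | m
    · simp
    · rw [Nat.add_sub_cancel]
      ring
  rw [polyLaplacian_mul, h, polyLaplacian_linForm_pow hx, polyLaplacian_normSqPoly_pow]
  simp only [smul_eq_C_mul, map_mul, map_add, map_sub, map_natCast, map_ofNat]
  ring

theorem fischer_monomial (α : Fin n →₀ ℕ) (q : MvPolynomial (Fin n) ℝ) :
    fischer n (monomial α 1) q = ((∏ i, (α i).factorial : ℕ) : ℝ) * coeff α q := by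
  have h := (basisMonomials (Fin n) ℝ).constr_basis ℝ (fun α : Fin n →₀ ℕ =>
    ((∏ i, (α i).factorial : ℕ) : ℝ) • lcoeff ℝ α) α
  rw [coe_basisMonomials] at h
  simp only [fischer, h]
  simp

theorem fischer_eq_sum (p q : MvPolynomial (Fin n) ℝ) :
    fischer n p q =
      ∑ α ∈ p.support, coeff α p * (((∏ i, (α i).factorial : ℕ) : ℝ) * coeff α q) := by
  conv_lhs => rw [p.as_sum]
  simp only [map_sum, LinearMap.sum_apply]
  refine Finset.sum_congr rfl fun α _ => ?_
  rw [← mul_one (coeff α p), ← smul_eq_mul, ← smul_monomial, map_smul, LinearMap.smul_apply,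
    fischer_monomial]
  simp

theorem fischer_self_nonneg (p : MvPolynomial (Fin n) ℝ) : 0 ≤ fischer n p p := by
  rw [fischer_eq_sum]
  refine Finset.sum_nonneg fun α _ => ?_
  rw [mul_left_comm]
  exact mul_nonneg (Nat.cast_nonneg _) (mul_self_nonneg _)

theorem fischer_X_mul (i : Fin n) (p q : MvPolynomial (Fin n) ℝ) :
    fischer n (X i * p) q = fischer n p (pderiv i q) := by
  have h : fischer n ∘ₗ LinearMap.mulLeft ℝ (X i) =
      (fischer n).compl₂ (pderiv i).toLinearMap := by
    refine (basisMonomials (Fin n) ℝ).ext fun α => LinearMap.ext fun q => ?_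
    have hfac : ∏ j, ((α + Finsupp.single i 1 : Fin n →₀ ℕ) j).factorial =
        (∏ j, (α j).factorial) * (α i + 1) := by
      rw [← Finset.mul_prod_erase _ _ (Finset.mem_univ i),
        ← Finset.mul_prod_erase _ (fun j => (α j).factorial) (Finset.mem_univ i)]
      have : ∏ j ∈ Finset.univ.erase i,
            ((α + Finsupp.single i 1 : Fin n →₀ ℕ) j).factorial =
          ∏ j ∈ Finset.univ.erase i, (α j).factorial :=
        Finset.prod_congr rfl fun j hj => by simp [(Finset.ne_of_mem_erase hj).symm]
      rw [this, Finsupp.add_apply, Finsupp.single_eq_same, Nat.factorial_succ]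
      ring
    rw [coe_basisMonomials]
    simp only [LinearMap.comp_apply, LinearMap.mulLeft_apply, LinearMap.compl₂_apply,
      Derivation.coeFn_coe]
    rw [mul_comm, X, monomial_mul, one_mul, fischer_monomial, fischer_monomial, coeff_pderiv,
      hfac]
    push_cast
    ring
  simpa using LinearMap.congr_fun (LinearMap.congr_fun h p) q

theorem fischer_normSqPoly_mul (p q : MvPolynomial (Fin n) ℝ) :
    fischer n (normSqPoly n * p) q = fischer n p (polyLaplacian n q) := by
  simp [normSqPoly, polyLaplacian_apply, Finset.sum_mul, sq, mul_assoc, fischer_X_mul]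

theorem fischer_linForm_mul (x : Fin n → ℝ) (p q : MvPolynomial (Fin n) ℝ) :
    fischer n (linForm x * p) q = fischer n p (∑ i, x i • pderiv i q) := by
  simp [linForm, Finset.sum_mul, C_mul', fischer_X_mul]

/-- The reproducing property of `⟨x, ·⟩ ^ k` for the Fischer inner product. -/
theorem fischer_linForm_pow (x : Fin n → ℝ) (k : ℕ) {q : MvPolynomial (Fin n) ℝ}
    (hq : q.IsHomogeneous k) : fischer n (linForm x ^ k) q = k.factorial * eval x q := by
  induction k generalizing q with
  | zero =>
    obtain ⟨a, rfl⟩ : ∃ a, q = C a := ⟨coeff 0 q, totalDegree_eq_zero_iff_eq_C.1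
      (Nat.le_zero.1 hq.totalDegree_le)⟩
    have := fischer_monomial (0 : Fin n →₀ ℕ) (C a)
    simpa using this
  | succ k ih =>
    rw [pow_succ', fischer_linForm_mul, ih]
    · have h := congrArg (eval x) hq.sum_X_mul_pderiv
      simp only [map_sum, map_mul, eval_X, nsmul_eq_mul, map_natCast] at h
      simp only [map_sum, smul_eval, h, Nat.factorial_succ]
      push_cast
      ring
    · refine IsHomogeneous.sum _ _ _ fun i _ => ?_
      rw [smul_eq_C_mul]
      simpa using (isHomogeneous_C (Fin n) (x i)).mul (hq.pderiv (i := i))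

theorem isHomogeneous_linForm (x : Fin n → ℝ) : (linForm x).IsHomogeneous 1 :=
  IsHomogeneous.sum _ _ _ fun i _ => by
    simpa using (isHomogeneous_C (Fin n) (x i)).mul (isHomogeneous_X ℝ i)

theorem isHomogeneous_normSqPoly : (normSqPoly n).IsHomogeneous 2 :=
  IsHomogeneous.sum _ _ _ fun i _ => isHomogeneous_X_pow i 2

end MvPolynomial

/-- Coefficients of the monic Gegenbauer polynomials of dimension `n`: the coefficient of
`t ^ (k - 2 * j)` in degree `k`. -/
noncomputable def zonalCoeff (n k : ℕ) : ℕ → ℝ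
  | 0 => 1
  | j + 1 => -(zonalCoeff n k j * ((k - 2 * j) * (k - 2 * j - 1)) /
      (2 * (j + 1) * (n + 2 * k - 2 * j - 4)))

/-- The monic Gegenbauer polynomial of degree `k` in dimension `n`. -/
noncomputable def zonal (n k : ℕ) (t : ℝ) : ℝ :=
  ∑ j ∈ Finset.range (k / 2 + 1), zonalCoeff n k j * t ^ (k - 2 * j)

open MvPolynomial in
/-- The zonal harmonic polynomial of degree `k` with pole `x`. -/
noncomputable def zonalPoly {n : ℕ} (k : ℕ) (x : Fin n → ℝ) : MvPolynomial (Fin n) ℝ :=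
  ∑ j ∈ Finset.range (k / 2 + 1),
    zonalCoeff n k j • (linForm x ^ (k - 2 * j) * normSqPoly n ^ j)

namespace MvPolynomial

variable {n : ℕ}

theorem eval_zonalPoly (k : ℕ) (x : Fin n → ℝ) {y : Fin n → ℝ} (hy : ∑ i, y i ^ 2 = 1) :
    eval y (zonalPoly k x) = zonal n k (∑ i, x i * y i) := by
  simp [zonalPoly, zonal, linForm, normSqPoly, smul_eval, hy]

theorem isHomogeneous_zonalPoly (k : ℕ) (x : Fin n → ℝ) : (zonalPoly k x).IsHomogeneous k := by
  refine IsHomogeneous.sum _ _ _ fun j hj => ?_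
  rw [smul_eq_C_mul]
  convert (isHomogeneous_C (Fin n) (zonalCoeff n k j)).mul
    (((isHomogeneous_linForm x).pow (k - 2 * j)).mul (isHomogeneous_normSqPoly.pow j)) using 1
  have := Finset.mem_range.1 hj
  lia

theorem polyLaplacian_zonalPoly [NeZero n] (k : ℕ) {x : Fin n → ℝ} (hx : ∑ i, x i ^ 2 = 1) :
    polyLaplacian n (zonalPoly k x) = 0 := by
  have hn : (1 : ℝ) ≤ n := by exact_mod_cast NeZero.one_le
  have partialSum (r : ℕ) (hr : 2 * r ≤ k) :
      polyLaplacian n (∑ j ∈ Finset.range (r + 1),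
        zonalCoeff n k j • (linForm x ^ (k - 2 * j) * normSqPoly n ^ j)) =
      (zonalCoeff n k r * ((k - 2 * r) * (k - 2 * r - 1))) •
        (linForm x ^ (k - 2 * r - 2) * normSqPoly n ^ r) := by
    induction r with
    | zero => simp [polyLaplacian_linForm_pow hx, smul_eq_C_mul, zonalCoeff]
    | succ r ih =>
      have hr' : (2 * (r + 1) : ℝ) ≤ k := by exact_mod_cast hr
      have hr0 : (0 : ℝ) ≤ r := r.cast_nonneg
      have hden : (n + 2 * k - 2 * r - 4 : ℝ) ≠ 0 := by linarith
      have hcast : ((k - 2 * (r + 1) : ℕ) : ℝ) = k - 2 * (r + 1) := by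
        push_cast [Nat.cast_sub hr]
        ring
      rw [Finset.sum_range_succ, map_add, ih (by lia), map_smul,
        polyLaplacian_linForm_pow_mul hx, hcast, Nat.add_sub_cancel, smul_add, smul_smul,
        smul_smul, show k - 2 * r - 2 = k - 2 * (r + 1) by lia, add_left_comm, ← add_smul]
      have hzero : zonalCoeff n k r * ((k - 2 * r) * (k - 2 * r - 1)) +
          zonalCoeff n k (r + 1) * (2 * ((r + 1 : ℕ) : ℝ) *
            (2 * (k - 2 * (r + 1)) + 2 * ((r + 1 : ℕ) : ℝ) - 2 + n)) = 0 := by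
        have hfactor : 2 * ((r + 1 : ℕ) : ℝ) *
            (2 * (k - 2 * (r + 1)) + 2 * ((r + 1 : ℕ) : ℝ) - 2 + n) =
            2 * (r + 1) * (n + 2 * k - 2 * r - 4) := by
          push_cast
          ring
        rw [zonalCoeff, hfactor, neg_mul, div_mul_cancel₀ _ (by positivity), add_neg_cancel]
      rw [hzero, zero_smul, add_zero]
      push_cast
      rfl
  rw [zonalPoly, partialSum _ (by lia)]
  have h : ((k : ℝ) - 2 * (k / 2 : ℕ)) * (k - 2 * (k / 2 : ℕ) - 1) = 0 := by
    rcases Nat.even_or_odd' k with ⟨m, rfl | rfl⟩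
    · simp
    · rw [show (2 * m + 1) / 2 = m by lia]
      push_cast
      ring
  rw [h, mul_zero, zero_smul]

theorem fischer_zonalPoly [NeZero n] (k : ℕ) {x y : Fin n → ℝ} (hx : ∑ i, x i ^ 2 = 1)
    (hy : ∑ i, y i ^ 2 = 1) :
    fischer n (zonalPoly k x) (zonalPoly k y) = k.factorial * zonal n k (∑ i, x i * y i) := by
  have hsplit : zonalPoly k x = linForm x ^ k + normSqPoly n * ∑ j ∈ Finset.range (k / 2),
      zonalCoeff n k (j + 1) • (linForm x ^ (k - 2 * (j + 1)) * normSqPoly n ^ j) := by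
    rw [zonalPoly, Finset.sum_range_succ', Finset.mul_sum, add_comm]
    congr 1
    · simp [zonalCoeff]
    · refine Finset.sum_congr rfl fun j _ => ?_
      rw [pow_succ, mul_smul_comm]
      congr 1
      ring
  rw [hsplit, map_add, LinearMap.add_apply, fischer_normSqPoly_mul,
    polyLaplacian_zonalPoly k hy, map_zero, add_zero,
    fischer_linForm_pow x k (isHomogeneous_zonalPoly k y), eval_zonalPoly k y hx]
  simp_rw [mul_comm (y _)]

end MvPolynomial

/-- Schoenberg's theorem: the Gegenbauer polynomials are positive definite on the sphere. -/
theorem sum_zonal_inner_nonneg {n : ℕ} [NeZero n] {ι : Type*} (s : Finset ι)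
    {x : ι → EuclideanSpace ℝ (Fin n)} (hx : ∀ i, ‖x i‖ = 1) (k : ℕ) :
    0 ≤ ∑ i ∈ s, ∑ j ∈ s, zonal n k ⟪x i, x j⟫ := by
  have hsq (i : ι) : ∑ a, x i a ^ 2 = 1 := by
    rw [← EuclideanSpace.real_norm_sq_eq, hx, one_pow]
  have hinner (i j : ι) : ∑ a, x j a * x i a = ⟪x i, x j⟫ := by
    simp [PiLp.inner_apply]
  have h := MvPolynomial.fischer_self_nonneg (∑ i ∈ s, zonalPoly k (x i))
  simp only [map_sum, LinearMap.sum_apply, MvPolynomial.fischer_zonalPoly k (hsq _) (hsq _),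
    ← Finset.mul_sum, hinner] at h
  exact nonneg_of_mul_nonneg_right h (by positivity)

open Finset in
/-- If points of a kissing configuration all lie in the cap of height `11 / 15` around `e`, their
total excess height is at most that of the single point `e`. -/
theorem sum_inner_sub_le {E ι : Type*} [NormedAddCommGroup E] [InnerProductSpace ℝ E]
    (s : Finset ι) {x : ι → E} {e : E} (he : ‖e‖ = 1) (hx : ∀ i, ‖x i‖ = 1)
    (hsep : ∀ i j, i ≠ j → ⟪x i, x j⟫ ≤ 1 / 2) :
    ∑ i ∈ s, (⟪e, x i⟫ - 11 / 15) ≤ 4 / 15 := by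
  classical
  have hgram : ‖∑ i ∈ s, x i‖ ^ 2 ≤ (#s : ℝ) * (#s + 1) / 2 := by
    rw [← real_inner_self_eq_norm_sq, sum_inner]
    simp_rw [inner_sum]
    have hrow : ∀ i ∈ s, ∑ j ∈ s, ⟪x i, x j⟫ ≤ ((#s : ℝ) + 1) / 2 := fun i hi => by
      calc ∑ j ∈ s, ⟪x i, x j⟫ ≤ ∑ j ∈ s, (1 / 2 + if i = j then 1 / 2 else 0 : ℝ) := by
            refine sum_le_sum fun j _ => ?_
            split_ifs with h
            · rw [h, real_inner_self_eq_norm_sq, hx]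
              norm_num
            · simpa using hsep i j h
        _ = ((#s : ℝ) + 1) / 2 := by
            rw [sum_add_distrib, sum_ite_eq, if_pos hi, sum_const, nsmul_eq_mul]
            ring
    calc ∑ i ∈ s, ∑ j ∈ s, ⟪x i, x j⟫ ≤ ∑ i ∈ s, ((#s : ℝ) + 1) / 2 := sum_le_sum hrow
      _ = (#s : ℝ) * (#s + 1) / 2 := by
          rw [sum_const, nsmul_eq_mul]
          ring
  have hcard : (0 : ℝ) ≤ ((#s : ℝ) - 1) * (17 * #s - 32) := by
    rcases Nat.lt_or_ge #s 2 with h | h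
    · interval_cases #s <;> norm_num
    · have h' : (2 : ℝ) ≤ #s := by exact_mod_cast h
      exact mul_nonneg (by linarith) (by linarith)
  have hnorm : ‖∑ i ∈ s, x i‖ ≤ 4 / 15 + 11 / 15 * #s :=
    abs_le_of_sq_le_sq' (by nlinarith) (by positivity) |>.2
  have hinner : ∑ i ∈ s, ⟪e, x i⟫ ≤ ‖∑ i ∈ s, x i‖ := by
    rw [← inner_sum]
    simpa [he] using real_inner_le_norm e (∑ i ∈ s, x i)
  rw [sum_sub_distrib, sum_const, nsmul_eq_mul]
  linarith

/-- The test polynomial of the linear programming bound in dimension 16. -/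
noncomputable def kissingPoly (t : ℝ) : ℝ :=
  (t - 1 / 2) * (t + 11 / 15) * ((t + 269 / 500) * (t + 17 / 40) * (t + 149 / 1000) *
    (t - 22 / 125)) ^ 2 * (t ^ 3 - 12337 / 10000 * t ^ 2 - 7543 / 10000 * t + 69 / 40)

/-- The coefficients of `kissingPoly` in the basis of monic Gegenbauer polynomials. -/
noncomputable def kissingCoeff : ℕ → ℝ
  | 0 => 17077283539381572300043231 / 51480000000000000000000000000
  | 1 => 26765399016458588316532093 / 6435000000000000000000000000
  | 2 => 5578303519854196206854849 / 214500000000000000000000000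
  | 3 => 14406641457638452219215059 / 134062500000000000000000000
  | 4 => 6353868957189170886275057 / 19500000000000000000000000
  | 5 => 49026227784799459561709 / 65000000000000000000000
  | 6 => 10107668949049271959729 / 7500000000000000000000
  | 7 => 22939010307296268161 / 12750000000000000000
  | 8 => 857564131762912993 / 510000000000000000
  | 9 => 69627002577183 / 85000000000000
  | 10 => 1551611 / 45000000000
  | 11 => 1453 / 23750000
  | 12 => 26149 / 30000
  | 13 => 1
  | _ => 0

theorem kissingCoeff_nonneg (k : ℕ) : 0 ≤ kissingCoeff k := by
  unfold kissingCoeff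
  split <;> norm_num

theorem kissingPoly_eq_sum_zonal (t : ℝ) :
    kissingPoly t = ∑ k ∈ Finset.range 14, kissingCoeff k * zonal 16 k t := by
  norm_num [kissingPoly, kissingCoeff, zonal, zonalCoeff, Finset.sum_range_succ]
  ring

theorem kissingCubic_nonneg {t : ℝ} (h₁ : -1 ≤ t) (h₂ : t ≤ 1 / 2) :
    0 ≤ t ^ 3 - 12337 / 10000 * t ^ 2 - 7543 / 10000 * t + 69 / 40 := by
  nlinarith [mul_nonneg (sub_nonneg.2 h₁) (sub_nonneg.2 h₂), sq_nonneg (t + 1),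
    mul_nonneg (sub_nonneg.2 h₁) (mul_nonneg (sub_nonneg.2 h₁) (sub_nonneg.2 h₂)),
    mul_nonneg (sub_nonneg.2 h₂) (mul_nonneg (sub_nonneg.2 h₁) (sub_nonneg.2 h₂))]

theorem kissingPoly_nonpos {t : ℝ} (h₁ : -(11 / 15) ≤ t) (h₂ : t ≤ 1 / 2) :
    kissingPoly t ≤ 0 := by
  refine mul_nonpos_of_nonpos_of_nonneg (mul_nonpos_of_nonpos_of_nonneg
    (mul_nonpos_of_nonpos_of_nonneg (by linarith) (by linarith)) (sq_nonneg _)) ?_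
  exact kissingCubic_nonneg (by linarith) h₂

/-- The slope of `kissingPoly` between `-11 / 15` and any point to its left. -/
theorem kissingPoly_slope_le {t : ℝ} (h₁ : -1 ≤ t) (h₂ : t ≤ -(11 / 15)) :
    (1 / 2 - t) * ((t + 269 / 500) * (t + 17 / 40) * (t + 149 / 1000) *
      (t - 22 / 125)) ^ 2 * (t ^ 3 - 12337 / 10000 * t ^ 2 - 7543 / 10000 * t + 69 / 40) ≤
    7 / 250 := by
  rw [← sub_nonneg]
  rcases le_total t (-(24 / 25)) with h | h
  · obtain ⟨u, hu⟩ : ∃ u, u = t + 1 := ⟨_, rfl⟩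
    obtain ⟨v, hv⟩ : ∃ v, v = -(24 / 25) - t := ⟨_, rfl⟩
    have hu₀ : 0 ≤ u := by linarith
    have hv₀ : 0 ≤ v := by linarith
    have hpos : 0 ≤ 30651188477936294359 / 262144 * u ^ 0 * v ^ 12 +
      51868507918306596722079 / 52428800 * u ^ 1 * v ^ 11 +
      1191181407270736155354717 / 327680000 * u ^ 2 * v ^ 10 +
      123408116322173318223885283 / 16384000000 * u ^ 3 * v ^ 9 +
      785166252633342655281907689 / 81920000000 * u ^ 4 * v ^ 8 +
      805789398080495532128457557 / 102400000000 * u ^ 5 * v ^ 7 +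
      2071041970116400108105909961 / 409600000000 * u ^ 6 * v ^ 6 +
      1791017941442024367258658023 / 409600000000 * u ^ 7 * v ^ 5 +
      391790584054459122771852771 / 81920000000 * u ^ 8 * v ^ 4 +
      126181683098951059567330729 / 32768000000 * u ^ 9 * v ^ 3 +
      775375742698004272638577113 / 409600000000 * u ^ 10 * v ^ 2 +
      105330212984776316070166343 / 204800000000 * u ^ 11 * v ^ 1 +
      6115371824485524862551547 / 102400000000 * u ^ 12 * v ^ 0 := by
      positivity
    convert hpos using 1
    rw [hu, hv]
    ring
  · obtain ⟨u, hu⟩ : ∃ u, u = t + 24 / 25 := ⟨_, rfl⟩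
    obtain ⟨v, hv⟩ : ∃ v, v = -(11 / 15) - t := ⟨_, rfl⟩
    have hu₀ : 0 ≤ u := by linarith
    have hv₀ : 0 ≤ v := by linarith
    have hpos : 0 ≤ 3249959317776411818479256689227 / 59660517092327526400000000 * u ^ 0 * v ^ 12 +
      202791659770784999887691198498163 / 119321034184655052800000000 * u ^ 1 * v ^ 11 +
      4841832655774585271303310537060633 / 238642068369310105600000000 * u ^ 2 * v ^ 10 +
      419737186752113079538521305792769 / 3818273093908961689600000 * u ^ 3 * v ^ 9 +
      16276903056175915895632232662815201 / 47728413673862021120000000 * u ^ 4 * v ^ 8 +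
      162571116101397812350899585441944643 / 238642068369310105600000000 * u ^ 5 * v ^ 7 +
      222038406360948967869150975044185101 / 238642068369310105600000000 * u ^ 6 * v ^ 6 +
      53309903963957087182499392166262087 / 59660517092327526400000000 * u ^ 7 * v ^ 5 +
      28955276176110321315325066927451289 / 47728413673862021120000000 * u ^ 8 * v ^ 4 +
      2734250699946232622902602321643311 / 9545682734772404224000000 * u ^ 9 * v ^ 3 +
      85732601423939936716604845050279 / 954568273477240422400000 * u ^ 10 * v ^ 2 +
      12878139907090494715179828909051 / 763654618781792337920000 * u ^ 11 * v ^ 1 +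
      54926485700421291285290635087 / 38182730939089616896000 * u ^ 12 * v ^ 0 := by
      positivity
    convert hpos using 1
    rw [hu, hv]
    ring

theorem kissingPoly_le {t : ℝ} (h₁ : -1 ≤ t) (h₂ : t ≤ -(11 / 15)) :
    kissingPoly t ≤ 7 / 250 * (-t - 11 / 15) := by
  have h := mul_le_mul_of_nonneg_right (kissingPoly_slope_le h₁ h₂)
    (show 0 ≤ -t - 11 / 15 by linarith)
  rw [kissingPoly]
  linarith

theorem kissingPoly_one_lt : kissingPoly 1 + 7 / 250 * (4 / 15) < 8313 * kissingCoeff 0 := by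
  norm_num [kissingPoly, kissingCoeff]

/-- The linear programming inequality for the row sums of `kissingPoly`. -/
theorem sum_kissingPoly_inner_le {E ι : Type*} [NormedAddCommGroup E] [InnerProductSpace ℝ E]
    [Fintype ι] {x : ι → E} (hx : ∀ i, ‖x i‖ = 1)
    (hsep : ∀ i j, i ≠ j → ⟪x i, x j⟫ ≤ 1 / 2) (i : ι) :
    ∑ j, kissingPoly ⟪x i, x j⟫ ≤ kissingPoly 1 + 7 / 250 * (4 / 15) := by
  classical
  rw [← Finset.add_sum_erase _ _ (Finset.mem_univ i), real_inner_self_eq_norm_sq, hx, one_pow]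
  refine add_le_add_right ?_ _
  have hcap := sum_inner_sub_le ((Finset.univ.erase i).filter fun j => ⟪x i, x j⟫ ≤ -(11 / 15))
    (e := -x i) (by rw [norm_neg, hx]) hx hsep
  refine le_trans ?_ (mul_le_mul_of_nonneg_left hcap (by norm_num))
  rw [Finset.mul_sum, Finset.sum_filter]
  refine Finset.sum_le_sum fun j hj => ?_
  have hij := hsep i j (Finset.ne_of_mem_erase hj).symm
  split_ifs with h
  · rw [inner_neg_left]
    refine kissingPoly_le ?_ h
    have := neg_le_of_abs_le (abs_real_inner_le_norm (x i) (x j))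
    rwa [hx, hx, one_mul] at this
  · exact kissingPoly_nonpos (not_le.1 h).le hij

/-- The kissing number in dimension 16 is at most 8312. -/
theorem kissing_dim16_le (N : ℕ)
    (x : Fin N → EuclideanSpace ℝ (Fin 16))
    (hx : ∀ i, ‖x i‖ = 1)
    (hsep : ∀ i j, i ≠ j → ⟪x i, x j⟫ ≤ 1 / 2) :
    N ≤ 8312 := by
  have hupper : ∑ i, ∑ j, kissingPoly ⟪x i, x j⟫ ≤
      N * (kissingPoly 1 + 7 / 250 * (4 / 15)) := by
    simpa only [Finset.card_univ, Fintype.card_fin, nsmul_eq_mul] using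
      Finset.sum_le_card_nsmul Finset.univ _ _ fun i _ => sum_kissingPoly_inner_le hx hsep i
  have hlower : kissingCoeff 0 * N ^ 2 ≤ ∑ i, ∑ j, kissingPoly ⟪x i, x j⟫ := by
    have hswap : ∑ i, ∑ j, kissingPoly ⟪x i, x j⟫ =
        ∑ k ∈ Finset.range 14, kissingCoeff k * ∑ i, ∑ j, zonal 16 k ⟪x i, x j⟫ := by
      simp_rw [kissingPoly_eq_sum_zonal, Finset.mul_sum]
      simp_rw [fun i => Finset.sum_comm (s := Finset.univ (α := Fin N)) (t := Finset.range 14)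
        (f := fun j k => kissingCoeff k * zonal 16 k ⟪x i, x j⟫)]
      exact Finset.sum_comm
    have hzero : ∑ i, ∑ j, zonal 16 0 ⟪x i, x j⟫ = (N : ℝ) ^ 2 := by
      simp [zonal, zonalCoeff, sq]
    rw [hswap, ← hzero]
    exact Finset.single_le_sum
      (f := fun k => kissingCoeff k * ∑ i, ∑ j, zonal 16 k ⟪x i, x j⟫)
      (fun k _ => mul_nonneg (kissingCoeff_nonneg k) (sum_zonal_inner_nonneg _ hx k))
      (Finset.mem_range.2 (by norm_num))
  by_contra! hN
  have hN' : (8313 : ℝ) ≤ N := by exact_mod_cast hN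
  have hc := kissingCoeff_nonneg 0
  have hone := kissingPoly_one_lt
  have : kissingCoeff 0 * N ^ 2 < N * (8313 * kissingCoeff 0) :=
    (hlower.trans hupper).trans_lt (mul_lt_mul_of_pos_left hone (by linarith))
  nlinarith [mul_nonneg (mul_nonneg hc N.cast_nonneg) (sub_nonneg.2 hN')]
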